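/- arXiv:math/0304075 — 3 statements merged into one kernel-verified Lean document; each statement's English description precedes it below -/
import Mathlib

section
/- The associative algebra A[D] is Γ-graded simple (its only Γ-graded two-sided ideals are 0 and A[D]) if and only if A is Γ-graded D-simple (the only Γ-graded ideals I of A with D(I) ⊆ I are 0 and A). -/
/-- A skew-symmetric bicharacter `ε : Γ × Γ → F^×`. -/
def IsBichar {F : Type} [Field F] {Γ : Type} [AddCommGroup Γ] (ε : Γ → Γ → F) : Prop :=
  (∀ lam mu, ε lam mu * ε mu lam = 1) ∧
  (∀ lam mu nu, ε lam (mu + nu) = ε lam mu * ε lam nu)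

variable (F : Type) [Field F] (Γ : Type) [AddCommGroup Γ] [DecidableEq Γ]
  (A : Type) [Ring A] [Algebra F A]

/-- left multiplication operators -/
noncomputable def mulL : A →ₗ[F] Module.End F A := (Algebra.lmul F A).toLinearMap

variable {F Γ A}

/-- `f ∈ End_F(A)` is homogeneous of degree `δ`. -/
def IsHomogMap (𝒜 : Γ → Submodule F A) (δ : Γ) (f : Module.End F A) : Prop :=
  ∀ lam : Γ, ∀ a ∈ 𝒜 lam, f a ∈ 𝒜 (lam + δ)

/-- `f` is a homogeneous color-derivation of degree `δ`. -/
def IsColorDer (𝒜 : Γ → Submodule F A) (ε : Γ → Γ → F) (δ : Γ) (f : Module.End F A) : Prop :=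
  IsHomogMap 𝒜 δ f ∧
  ∀ lam : Γ, ∀ a ∈ 𝒜 lam, ∀ b : A, f (a * b) = f a * b + ε δ lam • (a * f b)

/-- `Der^ε(A)`: the F-span of homogeneous color derivations. -/
def DerE (𝒜 : Γ → Submodule F A) (ε : Γ → Γ → F) : Submodule F (Module.End F A) :=
  Submodule.span F {f | ∃ δ, IsColorDer 𝒜 ε δ f}

/-- `A` is ε-commutative. -/
def IsColorComm (𝒜 : Γ → Submodule F A) (ε : Γ → Γ → F) : Prop :=
  ∀ lam mu : Γ, ∀ a ∈ 𝒜 lam, ∀ b ∈ 𝒜 mu, a * b = ε lam mu • (b * a)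

/-- `D` is color-commutative. -/
def DColorComm (𝒜 : Γ → Submodule F A) (ε : Γ → Γ → F) (D : Submodule F (Module.End F A)) : Prop :=
  ∀ δ δ' f g, f ∈ D → g ∈ D → IsColorDer 𝒜 ε δ f → IsColorDer 𝒜 ε δ' g →
    f * g = ε δ δ' • (g * f)

/-- `D` is a Γ-graded subspace: it is spanned by its homogeneous color-derivations. -/
def DGraded (𝒜 : Γ → Submodule F A) (ε : Γ → Γ → F) (D : Submodule F (Module.End F A)) : Prop :=
  D = Submodule.span F {f | f ∈ D ∧ ∃ δ, IsColorDer 𝒜 ε δ f}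

/-- `A[D]`: the unital subalgebra of `End_F(A)` generated by left multiplications and `D`. -/
noncomputable def AD (D : Submodule F (Module.End F A)) : Subalgebra F (Module.End F A) :=
  Algebra.adjoin F (Set.range (mulL F A) ∪ (D : Set (Module.End F A)))

/-- `A` is Γ-graded `D`-simple. -/
def GradedDSimple (𝒜 : Γ → Submodule F A) [GradedAlgebra 𝒜] (D : Submodule F (Module.End F A)) :
    Prop :=
  ∀ I : Ideal A, Ideal.IsHomogeneous 𝒜 I → (∀ f ∈ D, ∀ x ∈ I, f x ∈ I) → I = ⊥ ∨ I = ⊤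

/-- F₁ = A^D -/
def F1 (D : Submodule F (Module.End F A)) : Submodule F A where
  carrier := {u | ∀ f ∈ D, f u = 0}
  add_mem' := by
    intro a b ha hb f hf
    rw [map_add, ha f hf, hb f hf, add_zero]
  zero_mem' := by intro f hf; exact map_zero f
  smul_mem' := by
    intro c x hx f hf
    rw [map_smul, hx f hf, smul_zero]

/-- the derived space `W = [A[D], A[D]]`. -/
def Wsub (𝒜 : Γ → Submodule F A) (ε : Γ → Γ → F) (D : Submodule F (Module.End F A)) :
    Submodule F (Module.End F A) :=
  Submodule.span F {w | ∃ γ γ' x y, x ∈ AD D ∧ y ∈ AD D ∧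
    IsHomogMap 𝒜 γ x ∧ IsHomogMap 𝒜 γ' y ∧ w = x * y - ε γ γ' • (y * x)}

/-- `F₁[D]`. -/
noncomputable def F1D (D : Submodule F (Module.End F A)) : Subalgebra F (Module.End F A) :=
  Algebra.adjoin F ((mulL F A '' (F1 D : Set A)) ∪ (D : Set (Module.End F A)))

/-- `𝒟 = Der^ε(A) ∩ F₁[D]`. -/
def DScr (𝒜 : Γ → Submodule F A) (ε : Γ → Γ → F) (D : Submodule F (Module.End F A)) :
    Set (Module.End F A) :=
  {f | f ∈ F1D D ∧ f ∈ DerE 𝒜 ε}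

variable {I : Type} [LinearOrder I]

/-- ordered product `d^α`. -/
noncomputable def dpow (d : I → Module.End F A) (α : I →₀ ℕ) : Module.End F A :=
  ((α.support.sort (· ≤ ·)).map fun i => d i ^ α i).prod

/-- membership in the index set 𝒥. -/
def inJ (ε : Γ → Γ → F) (δd : I → Γ) (α : I →₀ ℕ) : Prop :=
  (∀ i, ringChar F ≠ 0 → α i ≤ ringChar F - 1) ∧
  (∀ i, ε (δd i) (δd i) = -1 → α i ≤ 1)

/-- the degree of `d^α`. -/
def degJ (δd : I → Γ) (α : I →₀ ℕ) : Γ := α.sum fun i n => n • δd i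

/-- the subalgebra `S` of `End_F(A)` is Γ-graded simple. -/
def GradedSimpleAlgOn (𝒜 : Γ → Submodule F A) (S : Subalgebra F (Module.End F A)) : Prop :=
  ∀ L : Submodule F (Module.End F A),
    L ≤ Subalgebra.toSubmodule S →
    (∀ x ∈ S, ∀ y ∈ L, x * y ∈ L ∧ y * x ∈ L) →
    L = Submodule.span F {f | f ∈ L ∧ ∃ δ, IsHomogMap 𝒜 δ f} →
    (L = ⊥ ∨ L = Subalgebra.toSubmodule S)

/-- variant of 𝒥 without characteristic restriction -/
def inJ0 (ε : Γ → Γ → F) (δd : I → Γ) (α : I →₀ ℕ) : Prop :=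
  ∀ i, ε (δd i) (δd i) = -1 → α i ≤ 1

/-- the sum `Σ_{α ∈ J0} B d^α` is direct -/
def DirectOn (d : I → Module.End F A) (J0 : Set (I →₀ ℕ)) (Bs : Set A) : Prop :=
  ∀ (s : Finset (I →₀ ℕ)) (c : (I →₀ ℕ) → A), ↑s ⊆ J0 → (∀ α ∈ s, c α ∈ Bs) →
    (∑ α ∈ s, mulL F A (c α) * dpow d α) = 0 → ∀ α ∈ s, mulL F A (c α) * dpow d α = 0

/-- span of color brackets of homogeneous elements of `M` and `N` -/
def brkE (𝒜 : Γ → Submodule F A) (ε : Γ → Γ → F) (M N : Submodule F (Module.End F A)) :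
    Submodule F (Module.End F A) :=
  Submodule.span F {w | ∃ γ γ' x y, x ∈ M ∧ y ∈ N ∧
    IsHomogMap 𝒜 γ x ∧ IsHomogMap 𝒜 γ' y ∧ w = x * y - ε γ γ' • (y * x)}

set_option linter.unusedSectionVars false

theorem IsBichar.add_left {ε : Γ → Γ → F} (h : IsBichar ε) (a b c : Γ) :
    ε (a + b) c = ε a c * ε b c := by
  have h1 := h.1 (a + b) c
  have h2 := h.1 a c
  have h3 := h.1 b c
  rw [h.2 c a b] at h1
  have h4 : ε c a * ε c b ≠ 0 := right_ne_zero_of_mul_eq_one h1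
  apply mul_right_cancel₀ h4
  rw [h1]
  linear_combination (-1 : F) * h2 - ε a c * ε c a * h3

@[simp]
theorem mulL_apply_apply (a b : A) : mulL F A a b = a * b := rfl

theorem mulL_mem_AD (D : Submodule F (Module.End F A)) (a : A) : mulL F A a ∈ AD D :=
  Algebra.subset_adjoin (Or.inl ⟨a, rfl⟩)

theorem mem_AD_of_mem {D : Submodule F (Module.End F A)} {f : Module.End F A} (hf : f ∈ D) :
    f ∈ AD D :=
  Algebra.subset_adjoin (Or.inr hf)

section Graded

variable (𝒜 : Γ → Submodule F A)

/-- The submodule of endomorphisms that are homogeneous of degree `δ`. -/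
def homogMaps (δ : Γ) : Submodule F (Module.End F A) where
  carrier := {f | IsHomogMap 𝒜 δ f}
  add_mem' hf hg lam a ha := add_mem (hf lam a ha) (hg lam a ha)
  zero_mem' _ _ _ := zero_mem _
  smul_mem' c _ hf lam a ha := Submodule.smul_mem _ c (hf lam a ha)

variable {𝒜}

/-- An element of a span of homogeneous maps is a finite sum of homogeneous components. -/
theorem exists_components {P : Submodule F (Module.End F A)} {f : Module.End F A}
    (hf : f ∈ Submodule.span F {f | f ∈ P ∧ ∃ δ, IsHomogMap 𝒜 δ f}) :
    ∃ g : Γ →₀ Module.End F A, (∀ δ, g δ ∈ P ∧ IsHomogMap 𝒜 δ (g δ)) ∧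
      (g.sum fun _ x => x) = f := by
  have hle : Submodule.span F {f | f ∈ P ∧ ∃ δ, IsHomogMap 𝒜 δ f} ≤
      ⨆ δ, P ⊓ homogMaps 𝒜 δ := by
    rw [Submodule.span_le]
    rintro f ⟨hfP, δ, hfδ⟩
    exact Submodule.mem_iSup_of_mem δ ⟨hfP, hfδ⟩
  obtain ⟨g, hg, hsum⟩ := (Submodule.mem_iSup_iff_exists_finsupp _ _).1 (hle hf)
  exact ⟨g, fun δ => hg δ, hsum⟩

variable [GradedAlgebra 𝒜]

theorem component_apply {g : Γ →₀ Module.End F A} (hg : ∀ δ, IsHomogMap 𝒜 δ (g δ))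
    (δ lam : Γ) {a : A} (ha : a ∈ 𝒜 lam) :
    (DirectSum.decompose 𝒜 ((g.sum fun _ x => x) a) (lam + δ) : A) = g δ a := by
  have key : ∀ δ', (DirectSum.decompose 𝒜 (g δ' a) (lam + δ) : A) =
      if δ' = δ then g δ a else 0 := by
    intro δ'
    split_ifs with h
    · subst h
      exact DirectSum.decompose_of_mem_same 𝒜 (hg _ lam a ha)
    · exact DirectSum.decompose_of_mem_ne 𝒜 (hg _ lam a ha) fun h' => h (add_left_cancel h')
  rw [Finsupp.sum, LinearMap.sum_apply, DirectSum.decompose_sum, DFinsupp.finsetSum_apply,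
    AddSubmonoidClass.coe_finsetSum, Finset.sum_congr rfl fun δ' _ => key δ',
    Finset.sum_ite_eq']
  split_ifs with h
  · rfl
  · rw [Finsupp.notMem_support_iff.1 h, LinearMap.zero_apply]

theorem mem_of_forall_homogeneous {f : Module.End F A} {P : Submodule F A}
    (h : ∀ lam, ∀ a ∈ 𝒜 lam, f a ∈ P) (a : A) : f a ∈ P := by
  classical
  rw [← DirectSum.sum_support_decompose 𝒜 a, map_sum]
  exact sum_mem fun i _ => h i _ (SetLike.coe_mem _)

theorem ext_homogeneous {f g : Module.End F A} (h : ∀ lam, ∀ a ∈ 𝒜 lam, f a = g a) : f = g := by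
  ext a
  have := mem_of_forall_homogeneous (𝒜 := 𝒜) (f := f - g) (P := ⊥)
    (fun lam b hb => by simp [h lam b hb]) a
  simpa [sub_eq_zero] using this

theorem isHomogMap_mulL {lam : Γ} {a : A} (ha : a ∈ 𝒜 lam) : IsHomogMap 𝒜 lam (mulL F A a) :=
  fun mu b hb => by
    rw [add_comm]
    exact SetLike.mul_mem_graded ha hb

theorem IsHomogMap.mul {γ γ' : Γ} {S T : Module.End F A} (hS : IsHomogMap 𝒜 γ S)
    (hT : IsHomogMap 𝒜 γ' T) : IsHomogMap 𝒜 (γ + γ') (S * T) := fun lam a ha => by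
  rw [add_comm γ, ← add_assoc]
  exact hS _ _ (hT lam a ha)

end Graded

/-- The color commutator of an operator `T`, regarded as having degree `γ`, with the left
multiplication by `b`, regarded as having degree `lam`. -/
noncomputable def colorComm (ε : Γ → Γ → F) (γ lam : Γ) (T : Module.End F A) (b : A) :
    Module.End F A :=
  T * mulL F A b - ε γ lam • (mulL F A b * T)

/-- `T` is a color-differential operator of degree `γ` and order less than `n`: every `n`-fold
color commutator with homogeneous multiplications vanishes. -/
def IsColorDiffOp (𝒜 : Γ → Submodule F A) (ε : Γ → Γ → F) : ℕ → Γ → Module.End F A → Prop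
  | 0, _, T => T = 0
  | n + 1, γ, T => ∀ lam, ∀ b ∈ 𝒜 lam, IsColorDiffOp 𝒜 ε n (γ + lam) (colorComm ε γ lam T b)

section DiffOp

variable {𝒜 : Γ → Submodule F A} {ε : Γ → Γ → F}

theorem isColorDiffOp_zero (n : ℕ) (γ : Γ) : IsColorDiffOp 𝒜 ε n γ 0 := by
  induction n generalizing γ with
  | zero => rfl
  | succ n ih =>
    intro lam b _
    simpa [colorComm] using ih (γ + lam)

theorem IsColorDiffOp.add {n : ℕ} {γ : Γ} {S T : Module.End F A}
    (hS : IsColorDiffOp 𝒜 ε n γ S) (hT : IsColorDiffOp 𝒜 ε n γ T) :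
    IsColorDiffOp 𝒜 ε n γ (S + T) := by
  induction n generalizing γ S T with
  | zero =>
    rw [IsColorDiffOp] at *
    rw [hS, hT, add_zero]
  | succ n ih =>
    intro lam b hb
    have : colorComm ε γ lam (S + T) b = colorComm ε γ lam S b + colorComm ε γ lam T b := by
      simp only [colorComm, add_mul, mul_add, smul_add]
      abel
    rw [this]
    exact ih (hS lam b hb) (hT lam b hb)

theorem IsColorDiffOp.smul {n : ℕ} {γ : Γ} {T : Module.End F A} (c : F)
    (hT : IsColorDiffOp 𝒜 ε n γ T) : IsColorDiffOp 𝒜 ε n γ (c • T) := by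
  induction n generalizing γ T with
  | zero =>
    rw [IsColorDiffOp] at *
    rw [hT, smul_zero]
  | succ n ih =>
    intro lam b hb
    have : colorComm ε γ lam (c • T) b = c • colorComm ε γ lam T b := by
      simp only [colorComm, smul_mul_assoc, mul_smul_comm, smul_sub]
      rw [smul_comm]
    rw [this]
    exact ih (hT lam b hb)

theorem IsColorDiffOp.succ {n : ℕ} {γ : Γ} {T : Module.End F A}
    (hT : IsColorDiffOp 𝒜 ε n γ T) : IsColorDiffOp 𝒜 ε (n + 1) γ T := by
  induction n generalizing γ T with
  | zero =>
    rw [IsColorDiffOp] at hT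
    rw [hT]
    exact isColorDiffOp_zero _ _
  | succ n ih => exact fun lam b hb => ih (hT lam b hb)

theorem IsColorDiffOp.mono {m n : ℕ} (hmn : m ≤ n) {γ : Γ} {T : Module.End F A}
    (hT : IsColorDiffOp 𝒜 ε m γ T) : IsColorDiffOp 𝒜 ε n γ T :=
  Nat.le_induction hT (fun _ _ => IsColorDiffOp.succ) n hmn

variable (𝒜 ε) in
/-- The submodule of color-differential operators of degree `γ` and arbitrary finite order. -/
def colorDiffOps (γ : Γ) : Submodule F (Module.End F A) where
  carrier := {T | ∃ n, IsColorDiffOp 𝒜 ε n γ T}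
  add_mem' := fun ⟨m, hS⟩ ⟨n, hT⟩ =>
    ⟨max m n, (hS.mono (le_max_left m n)).add (hT.mono (le_max_right m n))⟩
  zero_mem' := ⟨0, rfl⟩
  smul_mem' := fun c _ ⟨n, hT⟩ => ⟨n, hT.smul c⟩

theorem colorComm_mul (hε : IsBichar ε) (γ γ' lam : Γ) (S T : Module.End F A) (b : A) :
    colorComm ε (γ + γ') lam (S * T) b =
      S * colorComm ε γ' lam T b + ε γ' lam • (colorComm ε γ lam S b * T) := by
  simp only [colorComm, hε.add_left, mul_sub, sub_mul, smul_sub, mul_smul_comm, smul_mul_assoc,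
    smul_smul, mul_assoc, mul_comm (ε γ lam)]
  abel

theorem IsColorDiffOp.mul (hε : IsBichar ε) {m n : ℕ} {γ γ' : Γ} {S T : Module.End F A}
    (hS : IsColorDiffOp 𝒜 ε m γ S) (hT : IsColorDiffOp 𝒜 ε n γ' T) :
    IsColorDiffOp 𝒜 ε (m + n) (γ + γ') (S * T) := by
  induction m generalizing n γ γ' S T with
  | zero =>
    rw [IsColorDiffOp] at hS
    rw [hS, zero_mul]
    exact isColorDiffOp_zero _ _
  | succ m ihm =>
    induction n generalizing γ' T with
    | zero =>
      rw [IsColorDiffOp] at hT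
      rw [hT, mul_zero]
      exact isColorDiffOp_zero _ _
    | succ n ihn =>
      intro lam b hb
      rw [colorComm_mul hε]
      refine IsColorDiffOp.add ?_ (IsColorDiffOp.smul _ ?_)
      · have := ihn (hT lam b hb)
        rwa [← add_assoc] at this
      · have := ihm (hS lam b hb) hT
        rw [add_right_comm] at this
        rwa [show m + (n + 1) = m + 1 + n by omega] at this

theorem colorComm_mulL_eq_zero (hcomm : IsColorComm 𝒜 ε) {lam mu : Γ} {a b : A}
    (ha : a ∈ 𝒜 lam) (hb : b ∈ 𝒜 mu) : colorComm ε lam mu (mulL F A a) b = 0 := by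
  ext c
  have h := hcomm lam mu a ha b hb
  simp only [colorComm, LinearMap.sub_apply, LinearMap.smul_apply, Module.End.mul_apply,
    mulL_apply_apply, ← mul_assoc, h, smul_mul_assoc, sub_self, LinearMap.zero_apply]

theorem isColorDiffOp_mulL (hcomm : IsColorComm 𝒜 ε) {lam : Γ} {a : A} (ha : a ∈ 𝒜 lam) :
    IsColorDiffOp 𝒜 ε 1 lam (mulL F A a) :=
  fun _ _ hb => colorComm_mulL_eq_zero hcomm ha hb

theorem IsColorDer.colorComm_eq {δ lam : Γ} {f : Module.End F A} (hf : IsColorDer 𝒜 ε δ f)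
    {b : A} (hb : b ∈ 𝒜 lam) : colorComm ε δ lam f b = mulL F A (f b) := by
  ext c
  simp [colorComm, hf.2 lam b hb c]

theorem IsColorDer.isColorDiffOp (hcomm : IsColorComm 𝒜 ε) {δ : Γ} {f : Module.End F A}
    (hf : IsColorDer 𝒜 ε δ f) : IsColorDiffOp 𝒜 ε 2 δ f := by
  intro lam b hb
  rw [hf.colorComm_eq hb, add_comm]
  exact isColorDiffOp_mulL hcomm (hf.1 lam b hb)

variable [GradedAlgebra 𝒜]

theorem IsHomogMap.colorComm {γ lam : Γ} {T : Module.End F A} (hT : IsHomogMap 𝒜 γ T) {b : A}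
    (hb : b ∈ 𝒜 lam) : IsHomogMap 𝒜 (γ + lam) (colorComm ε γ lam T b) := by
  have h1 := hT.mul (isHomogMap_mulL hb)
  have h2 := (isHomogMap_mulL hb).mul hT
  rw [add_comm lam] at h2
  exact (homogMaps 𝒜 (γ + lam)).sub_mem h1 (Submodule.smul_mem _ _ h2)

/-- A homogeneous operator commuting in the color sense with all multiplications is itself a
multiplication. -/
theorem eq_mulL_of_colorComm_eq_zero (hε : IsBichar ε) (hcomm : IsColorComm 𝒜 ε) {γ : Γ}
    {T : Module.End F A} (hT : IsHomogMap 𝒜 γ T)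
    (h : ∀ lam, ∀ b ∈ 𝒜 lam, colorComm ε γ lam T b = 0) : T = mulL F A (T 1) := by
  refine ext_homogeneous (𝒜 := 𝒜) fun lam b hb => ?_
  have h1 : T 1 ∈ 𝒜 γ := by simpa using hT 0 1 SetLike.GradedOne.one_mem
  have h2 := LinearMap.congr_fun (h lam b hb) 1
  simp only [_root_.colorComm, LinearMap.sub_apply, LinearMap.smul_apply, Module.End.mul_apply,
    mulL_apply_apply, mul_one, LinearMap.zero_apply, sub_eq_zero] at h2
  rw [h2, mulL_apply_apply, hcomm lam γ b hb _ h1, smul_smul, hε.1, one_smul]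

theorem exists_mulL_mem (hε : IsBichar ε) (hcomm : IsColorComm 𝒜 ε)
    {L : Submodule F (Module.End F A)}
    (hL : ∀ b, ∀ y ∈ L, mulL F A b * y ∈ L ∧ y * mulL F A b ∈ L)
    {n : ℕ} {γ : Γ} {T : Module.End F A} (hTL : T ∈ L) (hTγ : IsHomogMap 𝒜 γ T)
    (hTn : IsColorDiffOp 𝒜 ε n γ T) (hT : T ≠ 0) : ∃ x ≠ 0, mulL F A x ∈ L := by
  induction n generalizing γ T with
  | zero => exact absurd hTn hT
  | succ n ih =>
    by_cases h : ∀ lam, ∀ b ∈ 𝒜 lam, colorComm ε γ lam T b = 0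
    · have hT1 := eq_mulL_of_colorComm_eq_zero hε hcomm hTγ h
      refine ⟨T 1, fun h0 => hT ?_, hT1 ▸ hTL⟩
      rw [hT1, h0, map_zero]
    · push Not at h
      obtain ⟨lam, b, hb, hne⟩ := h
      exact ih (sub_mem (hL b T hTL).2 (Submodule.smul_mem _ _ (hL b T hTL).1))
        (hTγ.colorComm hb) (hTn lam b hb) hne

end DiffOp

section Simplicity

variable {𝒜 : Γ → Submodule F A} [GradedAlgebra 𝒜] {ε : Γ → Γ → F}
  {D : Submodule F (Module.End F A)}

/-- `A[D]` is spanned by homogeneous color-differential operators. -/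
theorem AD_le_span_isColorDiffOp (hε : IsBichar ε) (hcomm : IsColorComm 𝒜 ε)
    (hDgr : DGraded 𝒜 ε D) :
    Subalgebra.toSubmodule (AD D) ≤ Submodule.span F
      {T | T ∈ AD D ∧ ∃ γ, IsHomogMap 𝒜 γ T ∧ ∃ n, IsColorDiffOp 𝒜 ε n γ T} := by
  have hmulL : ∀ a, mulL F A a ∈ Submodule.span F
      {T | T ∈ AD D ∧ ∃ γ, IsHomogMap 𝒜 γ T ∧ ∃ n, IsColorDiffOp 𝒜 ε n γ T} := by
    intro a
    classical
    rw [← DirectSum.sum_support_decompose 𝒜 a, map_sum]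
    exact sum_mem fun i _ => Submodule.subset_span ⟨mulL_mem_AD D _, i,
      isHomogMap_mulL (SetLike.coe_mem _), 1, isColorDiffOp_mulL hcomm (SetLike.coe_mem _)⟩
  intro T hT
  change T ∈ Algebra.adjoin F _ at hT
  induction hT using Algebra.adjoin_induction with
  | mem T hT =>
    obtain ⟨a, rfl⟩ | hT := hT
    · exact hmulL a
    · rw [SetLike.mem_coe, hDgr] at hT
      refine Submodule.span_mono ?_ hT
      rintro f ⟨hfD, δ, hf⟩
      exact ⟨mem_AD_of_mem hfD, δ, hf.1, 2, hf.isColorDiffOp hcomm⟩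
  | algebraMap c =>
    convert hmulL (algebraMap F A c) using 1
    ext x
    simp [Algebra.smul_def]
  | add S T _ _ hS hT => exact add_mem hS hT
  | mul S T _ _ hS hT =>
    have := Submodule.mul_mem_mul hS hT
    rw [Submodule.span_mul_span] at this
    refine Submodule.span_mono ?_ this
    rintro _ ⟨S, ⟨hS, γ, hSγ, m, hSm⟩, T, ⟨hT, γ', hTγ, n, hTn⟩, rfl⟩
    exact ⟨mul_mem hS hT, γ + γ', hSγ.mul hTγ, m + n, hSm.mul hε hTn⟩

/-- Every homogeneous element of `A[D]` is a color-differential operator. -/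
theorem exists_isColorDiffOp (hε : IsBichar ε) (hcomm : IsColorComm 𝒜 ε)
    (hDgr : DGraded 𝒜 ε D) {γ : Γ} {T : Module.End F A} (hT : T ∈ AD D)
    (hTγ : IsHomogMap 𝒜 γ T) : ∃ n, IsColorDiffOp 𝒜 ε n γ T := by
  have hle : Subalgebra.toSubmodule (AD D) ≤
      ⨆ δ, homogMaps 𝒜 δ ⊓ colorDiffOps 𝒜 ε δ := by
    refine (AD_le_span_isColorDiffOp hε hcomm hDgr).trans (Submodule.span_le.2 ?_)
    rintro f ⟨_, δ, hfδ, hf⟩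
    exact Submodule.mem_iSup_of_mem δ ⟨hfδ, hf⟩
  obtain ⟨g, hg, rfl⟩ := (Submodule.mem_iSup_iff_exists_finsupp _ _).1 (hle hT)
  have heq : (g.sum fun _ x => x) = g γ := ext_homogeneous (𝒜 := 𝒜) fun lam a ha => by
    rw [← component_apply (fun δ => (hg δ).1) γ lam ha,
      DirectSum.decompose_of_mem_same 𝒜 (hTγ lam a ha)]
  rw [heq]
  exact (hg γ).2

theorem AD_le_span_homogeneous (hε : IsBichar ε) (hcomm : IsColorComm 𝒜 ε)
    (hDgr : DGraded 𝒜 ε D) :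
    Subalgebra.toSubmodule (AD D) ≤ Submodule.span F
      {T | T ∈ Subalgebra.toSubmodule (AD D) ∧ ∃ γ, IsHomogMap 𝒜 γ T} :=
  (AD_le_span_isColorDiffOp hε hcomm hDgr).trans
    (Submodule.span_mono fun _ ⟨hT, γ, hTγ, _⟩ => ⟨hT, γ, hTγ⟩)

theorem mul_mem_right_of_isHomogeneous (hcomm : IsColorComm 𝒜 ε) {I : Ideal A}
    (hI : I.IsHomogeneous 𝒜) {x : A} (hx : x ∈ I) (a : A) : x * a ∈ I := by
  refine mem_of_forall_homogeneous (𝒜 := 𝒜) (f := mulL F A x) (P := I.restrictScalars F)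
    (fun lam b hb => ?_) a
  classical
  rw [mulL_apply_apply, ← DirectSum.sum_support_decompose 𝒜 x, Finset.sum_mul]
  refine sum_mem fun i _ => ?_
  rw [hcomm i lam _ (SetLike.coe_mem _) b hb]
  exact Submodule.smul_mem _ _ (I.mul_mem_left _ (hI i hx))

theorem apply_mem_of_mem_AD {I : Ideal A} (hID : ∀ f ∈ D, ∀ x ∈ I, f x ∈ I)
    {T : Module.End F A} (hT : T ∈ AD D) : ∀ x ∈ I, T x ∈ I := by
  change T ∈ Algebra.adjoin F _ at hT
  induction hT using Algebra.adjoin_induction with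
  | mem T hT =>
    obtain ⟨a, rfl⟩ | hT := hT
    · exact fun x hx => I.mul_mem_left a hx
    · exact hID T hT
  | algebraMap c => exact fun x hx => Submodule.smul_mem (I.restrictScalars F) c hx
  | add S T _ _ hS hT => exact fun x hx => add_mem (hS x hx) (hT x hx)
  | mul S T _ _ hS hT => exact fun x hx => hS _ (hT x hx)

/-- The operators in `A[D]` with image in a given ideal `I` of `A`. -/
def operatorsInto (D : Submodule F (Module.End F A)) (I : Ideal A) :
    Submodule F (Module.End F A) where
  carrier := {T | T ∈ AD D ∧ ∀ a, T a ∈ I}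
  add_mem' hS hT := ⟨add_mem hS.1 hT.1, fun a => add_mem (hS.2 a) (hT.2 a)⟩
  zero_mem' := ⟨zero_mem _, fun _ => zero_mem _⟩
  smul_mem' c _ hT := ⟨(AD D).smul_mem hT.1 c,
    fun a => Submodule.smul_mem (I.restrictScalars F) c (hT.2 a)⟩

theorem operatorsInto_eq_span (hε : IsBichar ε) (hcomm : IsColorComm 𝒜 ε)
    (hDgr : DGraded 𝒜 ε D) {I : Ideal A} (hI : I.IsHomogeneous 𝒜) :
    operatorsInto D I =
      Submodule.span F {f | f ∈ operatorsInto D I ∧ ∃ δ, IsHomogMap 𝒜 δ f} := by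
  refine le_antisymm (fun T hT => ?_) (Submodule.span_le.2 fun f hf => hf.1)
  obtain ⟨g, hg, rfl⟩ := exists_components (AD_le_span_homogeneous hε hcomm hDgr hT.1)
  refine sum_mem fun δ _ => Submodule.subset_span ⟨⟨(hg δ).1, ?_⟩, δ, (hg δ).2⟩
  refine mem_of_forall_homogeneous (𝒜 := 𝒜) (P := I.restrictScalars F) fun lam a ha => ?_
  rw [← component_apply (fun δ => (hg δ).2) δ lam ha]
  exact hI _ (hT.2 a)

theorem gradedDSimple_of_gradedSimpleAlgOn (hε : IsBichar ε) (hcomm : IsColorComm 𝒜 ε)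
    (hDgr : DGraded 𝒜 ε D) (h : GradedSimpleAlgOn 𝒜 (AD D)) : GradedDSimple 𝒜 D := by
  intro I hI hID
  rcases h (operatorsInto D I) (fun T hT => hT.1)
    (fun S hS T hT => ⟨⟨mul_mem hS hT.1, fun a => apply_mem_of_mem_AD hID hS _ (hT.2 a)⟩,
      ⟨mul_mem hT.1 hS, fun a => hT.2 (S a)⟩⟩)
    (operatorsInto_eq_span hε hcomm hDgr hI) with h0 | h1
  · left
    rw [eq_bot_iff]
    intro x hx
    have hmem : mulL F A x ∈ operatorsInto D I :=
      ⟨mulL_mem_AD D x, mul_mem_right_of_isHomogeneous hcomm hI hx⟩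
    rw [h0, Submodule.mem_bot] at hmem
    simpa using LinearMap.congr_fun hmem 1
  · right
    have hmem : (1 : Module.End F A) ∈ operatorsInto D I := by
      rw [h1]
      exact one_mem (AD D)
    exact (Ideal.eq_top_iff_one I).2 (hmem.2 1)

/-- The ideal of elements of `A` whose left multiplication lies in `L`. -/
def mulLIdeal (L : Submodule F (Module.End F A))
    (hL : ∀ b, ∀ y ∈ L, mulL F A b * y ∈ L) : Ideal A where
  carrier := {x | mulL F A x ∈ L}
  add_mem' hx hy := by simpa using add_mem hx hy
  zero_mem' := by simp
  smul_mem' b x hx := by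
    have : mulL F A (b * x) = mulL F A b * mulL F A x := map_mul (Algebra.lmul F A) b x
    simpa [this] using hL b _ hx

theorem isHomogeneous_mulLIdeal {L : Submodule F (Module.End F A)}
    (hL : ∀ b, ∀ y ∈ L, mulL F A b * y ∈ L)
    (hLgr : L = Submodule.span F {f | f ∈ L ∧ ∃ δ, IsHomogMap 𝒜 δ f}) :
    (mulLIdeal L hL).IsHomogeneous 𝒜 := by
  intro i x hx
  have hx' : mulL F A x ∈ L := hx
  rw [hLgr] at hx'
  obtain ⟨g, hg, hsum⟩ := exists_components hx'
  have heq : mulL F A (DirectSum.decompose 𝒜 x i : A) = g i :=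
    ext_homogeneous (𝒜 := 𝒜) fun lam a ha => by
      rw [← component_apply (fun δ => (hg δ).2) i lam ha, hsum, mulL_apply_apply,
        mulL_apply_apply, add_comm lam, DirectSum.coe_decompose_mul_add_of_right_mem 𝒜 ha]
  change mulL F A _ ∈ L
  rw [heq]
  exact (hg i).1

theorem apply_mem_mulLIdeal (hDgr : DGraded 𝒜 ε D) {L : Submodule F (Module.End F A)}
    (hL : ∀ x ∈ AD D, ∀ y ∈ L, x * y ∈ L ∧ y * x ∈ L)
    (hLgr : L = Submodule.span F {f | f ∈ L ∧ ∃ δ, IsHomogMap 𝒜 δ f}) {f : Module.End F A}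
    (hf : f ∈ D) {x : A} (hx : mulL F A x ∈ L) : mulL F A (f x) ∈ L := by
  rw [hDgr] at hf
  induction hf using Submodule.span_induction with
  | mem f hf =>
    obtain ⟨hfD, δ, hf⟩ := hf
    classical
    rw [← DirectSum.sum_support_decompose 𝒜 x, map_sum, map_sum]
    refine sum_mem fun i _ => ?_
    have hxi : mulL F A (DirectSum.decompose 𝒜 x i : A) ∈ L :=
      isHomogeneous_mulLIdeal (fun b y hy => (hL _ (mulL_mem_AD D b) y hy).1) hLgr i hx
    rw [← hf.colorComm_eq (SetLike.coe_mem _)]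
    have := hL f (mem_AD_of_mem hfD) _ hxi
    exact sub_mem this.1 (Submodule.smul_mem _ _ this.2)
  | zero => simp
  | add f g _ _ hf hg => simpa using add_mem hf hg
  | smul c f _ hf => simpa using Submodule.smul_mem _ c hf

theorem gradedSimpleAlgOn_of_gradedDSimple (hε : IsBichar ε) (hcomm : IsColorComm 𝒜 ε)
    (hDgr : DGraded 𝒜 ε D) (h : GradedDSimple 𝒜 D) : GradedSimpleAlgOn 𝒜 (AD D) := by
  intro L hLle hL hLgr
  have hLA : ∀ b, ∀ y ∈ L, mulL F A b * y ∈ L ∧ y * mulL F A b ∈ L :=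
    fun b => hL _ (mulL_mem_AD D b)
  refine or_iff_not_imp_left.2 fun hne => ?_
  obtain ⟨T, hTL, γ, hTγ, hT⟩ : ∃ T ∈ L, ∃ γ, IsHomogMap 𝒜 γ T ∧ T ≠ 0 := by
    by_contra! hcon
    refine hne ?_
    rw [hLgr, Submodule.span_eq_bot]
    rintro T ⟨hTL, γ, hTγ⟩
    exact hcon T hTL γ hTγ
  obtain ⟨n, hTn⟩ := exists_isColorDiffOp hε hcomm hDgr (hLle hTL) hTγ
  obtain ⟨x, hx, hxL⟩ := exists_mulL_mem hε hcomm hLA hTL hTγ hTn hT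
  have hone : mulL F A 1 ∈ L := by
    rcases h (mulLIdeal L fun b y hy => (hLA b y hy).1) (isHomogeneous_mulLIdeal _ hLgr)
      (fun f hf y hy => apply_mem_mulLIdeal hDgr hL hLgr hf hy) with h0 | h1
    · have hx0 : x ∈ mulLIdeal L fun b y hy => (hLA b y hy).1 := hxL
      rw [h0] at hx0
      exact absurd hx0 hx
    · exact (Ideal.eq_top_iff_one _).1 h1
  have hone' : mulL F A 1 = 1 := map_one (Algebra.lmul F A)
  refine le_antisymm hLle fun S hS => ?_
  simpa [hone'] using (hL S hS _ hone).1

end Simplicity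

theorem stmt_0
    (𝒜 : Γ → Submodule F A) [GradedAlgebra 𝒜] (ε : Γ → Γ → F)
    (D : Submodule F (Module.End F A))
    (hchar : (2 : F) ≠ 0)
    (hbich : IsBichar ε)
    (hcomm : IsColorComm 𝒜 ε)
    (hDder : D ≤ DerE 𝒜 ε)
    (hDgr : DGraded 𝒜 ε D)
    (hDcc : DColorComm 𝒜 ε D)
    :
    GradedSimpleAlgOn 𝒜 (AD D) ↔ GradedDSimple 𝒜 D := by
  exact ⟨gradedDSimple_of_gradedSimpleAlgOn hbich hcomm hDgr,
    gradedSimpleAlgOn_of_gradedDSimple hbich hcomm hDgr⟩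
end

section
/- A ∩ A[D]D = 0, i.e. no nonzero operator of left multiplication by an element of A lies in the left ideal A[D]D of A[D] generated by D. -/
variable (F : Type) [Field F] (Γ : Type) [AddCommGroup Γ] [DecidableEq Γ]
  (A : Type) [Ring A] [Algebra F A]

variable {F Γ A}

variable {I : Type} [LinearOrder I]

/-- A skew-symmetric bicharacter is trivial on the pairs `(δ, 0)`. -/
theorem IsBichar.apply_zero {F : Type} [Field F] {Γ : Type} [AddCommGroup Γ] {ε : Γ → Γ → F}
    (h : IsBichar ε) (δ : Γ) : ε δ 0 = 1 := by
  have h0 : ε δ 0 ≠ 0 := left_ne_zero_of_mul_eq_one (h.1 δ 0)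
  have h1 := h.2 δ 0 0
  rw [add_zero] at h1
  exact (mul_eq_left₀ h0).1 h1.symm

/-- A homogeneous color-derivation annihilates `1`. -/
theorem IsColorDer.map_one {F : Type} [Field F] {Γ : Type} [AddCommGroup Γ] [DecidableEq Γ]
    {A : Type} [Ring A] [Algebra F A] {𝒜 : Γ → Submodule F A} [GradedAlgebra 𝒜] {ε : Γ → Γ → F}
    (hε : IsBichar ε) {δ : Γ} {f : Module.End F A} (hf : IsColorDer 𝒜 ε δ f) : f 1 = 0 := by
  have h := hf.2 0 1 (SetLike.GradedOne.one_mem) 1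
  rwa [hε.apply_zero, one_smul, mul_one, mul_one, one_mul, left_eq_add] at h

/-- Every element of `Der^ε(A)` annihilates `1`. -/
theorem map_one_of_mem_DerE {F : Type} [Field F] {Γ : Type} [AddCommGroup Γ] [DecidableEq Γ]
    {A : Type} [Ring A] [Algebra F A] {𝒜 : Γ → Submodule F A} [GradedAlgebra 𝒜] {ε : Γ → Γ → F}
    (hε : IsBichar ε) {f : Module.End F A} (hf : f ∈ DerE 𝒜 ε) : f 1 = 0 := by
  have h : DerE 𝒜 ε ≤ LinearMap.ker (LinearMap.applyₗ (R := F) (M₂ := A) (1 : A)) :=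
    Submodule.span_le.2 fun _ ⟨_, hg⟩ => hg.map_one hε
  exact h hf

theorem stmt_2
    (𝒜 : Γ → Submodule F A) [GradedAlgebra 𝒜] (ε : Γ → Γ → F)
    (D : Submodule F (Module.End F A))
    (hchar : (2 : F) ≠ 0)
    (hbich : IsBichar ε)
    (hcomm : IsColorComm 𝒜 ε)
    (hDder : D ≤ DerE 𝒜 ε)
    (hDgr : DGraded 𝒜 ε D)
    (hDcc : DColorComm 𝒜 ε D)
    :
    ∀ a : A, mulL F A a ∈
      Submodule.span F {y : Module.End F A | ∃ x ∈ AD D, ∃ f ∈ D, y = x * f} →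
      a = 0 := by
  intro a ha
  have h : Submodule.span F {y : Module.End F A | ∃ x ∈ AD D, ∃ f ∈ D, y = x * f} ≤
      LinearMap.ker (LinearMap.applyₗ (R := F) (M₂ := A) (1 : A)) := by
    refine Submodule.span_le.2 ?_
    rintro _ ⟨x, -, f, hf, rfl⟩
    change x (f 1) = 0
    rw [map_one_of_mem_DerE hbich (hDder hf), map_zero]
  have h1 : a * 1 = 0 := h ha
  rwa [mul_one] at h1
end

section
/- Suppose A is Γ-graded D-simple. If x d^α = 0 for some nonzero homogeneous x ∈ A and some α ∈ J, then d^α = 0 as an operator on A. -/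
variable (F : Type) [Field F] (Γ : Type) [AddCommGroup Γ] [DecidableEq Γ]
  (A : Type) [Ring A] [Algebra F A]

variable {F Γ A}

variable {I : Type} [LinearOrder I]

theorem IsHomogMap.one (𝒜 : Γ → Submodule F A) : IsHomogMap 𝒜 0 (1 : Module.End F A) := by
  intro lam a ha
  simpa using ha

theorem IsHomogMap.mul_s4 {𝒜 : Γ → Submodule F A} {δ δ' : Γ} {f g : Module.End F A}
    (hf : IsHomogMap 𝒜 δ f) (hg : IsHomogMap 𝒜 δ' g) : IsHomogMap 𝒜 (δ' + δ) (f * g) := by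
  intro lam a ha
  rw [← add_assoc]
  exact hf _ _ (hg _ _ ha)

/-- The homogeneous operators that commute with every `d i` up to a scalar. -/
def scalarCommutant (𝒜 : Γ → Submodule F A) (d : I → Module.End F A) :
    Submonoid (Module.End F A) where
  carrier := {T | (∃ η, IsHomogMap 𝒜 η T) ∧ ∀ i, ∃ c : F, d i * T = c • (T * d i)}
  one_mem' := ⟨⟨0, IsHomogMap.one 𝒜⟩, fun i => ⟨1, by simp⟩⟩
  mul_mem' := by
    rintro S T ⟨⟨η, hS⟩, hSc⟩ ⟨⟨θ, hT⟩, hTc⟩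
    refine ⟨⟨θ + η, hS.mul_s4 hT⟩, fun i => ?_⟩
    obtain ⟨c, hc⟩ := hSc i
    obtain ⟨e, he⟩ := hTc i
    refine ⟨c * e, ?_⟩
    rw [← mul_assoc, hc, smul_mul_assoc, mul_assoc, he, mul_smul_comm, smul_smul, mul_assoc]

theorem dpow_mem {d : I → Module.End F A} {M : Submonoid (Module.End F A)}
    (h : ∀ i, d i ∈ M) (α : I →₀ ℕ) : dpow d α ∈ M := by
  refine Submonoid.list_prod_mem _ fun T hT => ?_
  obtain ⟨i, -, rfl⟩ := List.mem_map.1 hT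
  exact pow_mem (h i) _

/-- The left annihilator of the image of `T`. -/
def rangeAnnihilator (T : Module.End F A) : Ideal A where
  carrier := {x | ∀ a, x * T a = 0}
  add_mem' := by
    intro x y hx hy a
    rw [add_mul, hx a, hy a, add_zero]
  zero_mem' := fun a => zero_mul _
  smul_mem' := by
    intro c x hx a
    rw [smul_eq_mul, mul_assoc, hx a, mul_zero]

theorem rangeAnnihilator_isHomogeneous (𝒜 : Γ → Submodule F A) [GradedAlgebra 𝒜] {η : Γ}
    {T : Module.End F A} (hT : IsHomogMap 𝒜 η T) :
    Ideal.IsHomogeneous 𝒜 (rangeAnnihilator T) := by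
  intro lam x hx a
  induction a using DirectSum.Decomposition.inductionOn 𝒜 with
  | zero => rw [map_zero, mul_zero]
  | @homogeneous mu m =>
    have h := DirectSum.coe_decompose_mul_add_of_right_mem 𝒜 (i := lam) (a := x)
      (hT mu m m.2)
    rw [← h, hx m, DirectSum.decompose_zero, DirectSum.zero_apply, ZeroMemClass.coe_zero]
  | add m n hm hn => rw [map_add, mul_add, hm, hn, add_zero]

theorem IsColorDer.map_mem_rangeAnnihilator {𝒜 : Γ → Submodule F A} [GradedAlgebra 𝒜]
    {ε : Γ → Γ → F} {δ η : Γ} {f T : Module.End F A} (hf : IsColorDer 𝒜 ε δ f)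
    (hT : IsHomogMap 𝒜 η T) {c : F} (hc : f * T = c • (T * f)) {x : A}
    (hx : x ∈ rangeAnnihilator T) : f x ∈ rangeAnnihilator T := by
  classical
  rw [← DirectSum.sum_support_decompose 𝒜 x, map_sum]
  refine sum_mem fun lam _ a => ?_
  have hy : ∀ b, (DirectSum.decompose 𝒜 x lam : A) * T b = 0 :=
    rangeAnnihilator_isHomogeneous 𝒜 hT lam hx
  have hfT : f (T a) = c • T (f a) := LinearMap.congr_fun hc a
  have h := hf.2 lam _ (DirectSum.decompose 𝒜 x lam).2 (T a)
  rw [hy a, map_zero, hfT, mul_smul_comm, hy, smul_zero, smul_zero, add_zero] at h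
  exact h.symm

theorem stmt_4
    (𝒜 : Γ → Submodule F A) [GradedAlgebra 𝒜] (ε : Γ → Γ → F)
    (D : Submodule F (Module.End F A))
    (hchar : (2 : F) ≠ 0)
    (hbich : IsBichar ε)
    (hcomm : IsColorComm 𝒜 ε)
    (hDder : D ≤ DerE 𝒜 ε)
    (hDgr : DGraded 𝒜 ε D)
    (hDcc : DColorComm 𝒜 ε D)
    (hDne : D ≠ ⊥)
    (hsimple : GradedDSimple 𝒜 D)
    (pd : I → Module.End F A) (δd : I → Γ)
    (hpdD : ∀ i, pd i ∈ D)
    (hpdhom : ∀ i, IsColorDer 𝒜 ε (δd i) (pd i))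
    (hpdind : LinearIndependent F pd)
    (hpdspan : Submodule.span F (Set.range pd) = D) :
    ∀ (x : A) (lam : Γ) (α : I →₀ ℕ), x ∈ 𝒜 lam → x ≠ 0 → inJ0 ε δd α →
      mulL F A x * dpow pd α = 0 → dpow pd α = 0 := by
  intro x _ α _ hx0 _ hxα
  obtain ⟨⟨η, hη⟩, hscalar⟩ : dpow pd α ∈ scalarCommutant 𝒜 pd :=
    dpow_mem (M := scalarCommutant 𝒜 pd) (fun i => ⟨⟨δd i, (hpdhom i).1⟩, fun j =>
      ⟨_, hDcc _ _ _ _ (hpdD j) (hpdD i) (hpdhom j) (hpdhom i)⟩⟩) α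
  have hxmem : x ∈ rangeAnnihilator (dpow pd α) := fun a => LinearMap.congr_fun hxα a
  have hstable : ∀ f ∈ D, ∀ y ∈ rangeAnnihilator (dpow pd α),
      f y ∈ rangeAnnihilator (dpow pd α) := by
    intro f hf y hy
    rw [← hpdspan] at hf
    induction hf using Submodule.span_induction with
    | mem g hg =>
      obtain ⟨i, rfl⟩ := hg
      obtain ⟨c, hc⟩ := hscalar i
      exact (hpdhom i).map_mem_rangeAnnihilator hη hc hy
    | zero => exact zero_mem _
    | add g h _ _ hg hh => exact add_mem hg hh
    | smul c g _ hg => exact Submodule.smul_of_tower_mem _ c hg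
  rcases hsimple _ (rangeAnnihilator_isHomogeneous 𝒜 hη) hstable with hbot | htop
  · rw [hbot] at hxmem
    exact absurd hxmem hx0
  · ext a
    have h1 : (1 : A) ∈ rangeAnnihilator (dpow pd α) := htop ▸ Submodule.mem_top
    simpa using h1 a
end
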